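/- (Positivity of the contact sets.) Let φ₋, φ₊ : ℝ^d → ℝ be non-constant C², (2πℤ)^d-periodic functions with φ₊ − φ₋ ≥ τ everywhere for some τ > 0, assume max φ₋ ≥ min φ₊, and let u be the unique continuous periodic solution of the double obstacle problem, with contact sets M₋(u) = {u = φ₋} and M₊(u) = {u = φ₊}. If max φ₋ > min φ₊, then both M₋(u)∩E and M₊(u)∩E have strictly positive Lebesgue measure. If max φ₋ = min φ₊, then M₊(u) = φ₊^{−1}(min φ₊) and M₋(u) = φ₋^{−1}(max φ₋). -/

import Mathlib

open MeasureTheory Real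

noncomputable section

/-- Euclidean space `ℝ^d`. -/
abbrev Rd (d : ℕ) := EuclideanSpace ℝ (Fin d)

/-- `f : ℝ^d → α` is `(2πℤ)^d`-periodic. -/
def PeriodicRd {d : ℕ} {α : Type*} (f : Rd d → α) : Prop :=
  ∀ (x : Rd d) (j : Fin d),
    f (x + (2 * Real.pi) • EuclideanSpace.single j (1 : ℝ)) = f x

/-- The Euclidean Laplacian `Δ = ∑ ∂²/∂xⱼ²`. -/
noncomputable def lapRd {d : ℕ} (f : Rd d → ℝ) (x : Rd d) : ℝ :=
  ∑ j : Fin d,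
    fderiv ℝ (fun y => fderiv ℝ f y (EuclideanSpace.single j (1 : ℝ))) x
      (EuclideanSpace.single j (1 : ℝ))

/-- The fundamental domain `E = [0,2π)^d`. -/
def EfdR (d : ℕ) : Set (Rd d) := {x | ∀ j : Fin d, x j ∈ Set.Ico 0 (2 * Real.pi)}

/-- `u` is a solution of the double obstacle problem with obstacles `φ₋ ≤ u ≤ φ₊`:
`u` is continuous, periodic, trapped between the obstacles, distributionally
subharmonic on `{u > φ₋}` and distributionally superharmonic on `{u < φ₊}`. -/
def IsDOPSolution {d : ℕ} (φm φp u : Rd d → ℝ) : Prop :=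
  Continuous u ∧ PeriodicRd u ∧ (∀ x, φm x ≤ u x ∧ u x ≤ φp x) ∧
    (∀ χ : Rd d → ℝ, ContDiff ℝ (⊤ : ℕ∞) χ → HasCompactSupport χ → (∀ x, 0 ≤ χ x) →
      tsupport χ ⊆ {x | φm x < u x} → 0 ≤ ∫ x : Rd d, u x * lapRd χ x) ∧
    (∀ χ : Rd d → ℝ, ContDiff ℝ (⊤ : ℕ∞) χ → HasCompactSupport χ → (∀ x, 0 ≤ χ x) →
      tsupport χ ⊆ {x | u x < φp x} → (∫ x : Rd d, u x * lapRd χ x) ≤ 0)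

/-! ### Periodic functions -/

/-- The lattice vector `2πz`. -/
def latticeVec {d : ℕ} (z : Fin d → ℤ) : Rd d :=
  ∑ j, z j • ((2 * Real.pi) • EuclideanSpace.single j (1 : ℝ))

lemma latticeVec_apply {d : ℕ} (z : Fin d → ℤ) (j : Fin d) :
    latticeVec z j = z j * (2 * Real.pi) := by
  simp [latticeVec, Pi.single_apply, mul_comm]

lemma PeriodicRd.add_latticeVec {d : ℕ} {α : Type*} {f : Rd d → α} (hf : PeriodicRd f)
    (z : Fin d → ℤ) (x : Rd d) : f (x + latticeVec z) = f x := by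
  have h : Function.Periodic f (latticeVec z) := by
    refine Finset.sum_induction _ (Function.Periodic f) (fun a b => Function.Periodic.add_period)
      (fun x => by simp) (fun j _ => Function.Periodic.zsmul (fun x => hf x j) _)
  exact h x

lemma exists_add_latticeVec_mem {d : ℕ} (x : Rd d) :
    ∃ z : Fin d → ℤ, x + latticeVec z ∈ EfdR d := by
  refine ⟨fun j => -⌊x j / (2 * Real.pi)⌋, fun j => ?_⟩
  have h2 := Real.two_pi_pos
  have h3 := Int.floor_le (x j / (2 * Real.pi))
  have h4 := Int.lt_floor_add_one (x j / (2 * Real.pi))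
  rw [le_div_iff₀ h2] at h3
  rw [div_lt_iff₀ h2] at h4
  simp only [PiLp.add_apply, latticeVec_apply, Int.cast_neg]
  constructor <;> linarith

lemma exists_isCompact_superset_EfdR (d : ℕ) : ∃ K : Set (Rd d), IsCompact K ∧ EfdR d ⊆ K := by
  refine ⟨WithLp.toLp 2 '' Set.univ.pi fun _ => Set.Icc (0 : ℝ) (2 * Real.pi),
    (isCompact_univ_pi fun _ => isCompact_Icc).image (PiLp.continuous_toLp 2 _), fun x hx => ?_⟩
  exact ⟨WithLp.ofLp x, fun j _ => Set.Ico_subset_Icc_self (hx j), rfl⟩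

lemma PeriodicRd.isCompact_range {d : ℕ} {f : Rd d → ℝ} (hf : PeriodicRd f) (hc : Continuous f) :
    IsCompact (Set.range f) := by
  obtain ⟨K, hK, hEK⟩ := exists_isCompact_superset_EfdR d
  have : Set.range f = f '' K := by
    refine subset_antisymm ?_ (Set.image_subset_range _ _)
    rintro _ ⟨x, rfl⟩
    obtain ⟨z, hz⟩ := exists_add_latticeVec_mem x
    exact ⟨_, hEK hz, hf.add_latticeVec z x⟩
  rw [this]
  exact hK.image hc

lemma PeriodicRd.uniformContinuous {d : ℕ} {f : Rd d → ℝ} (hf : PeriodicRd f)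
    (hc : Continuous f) : UniformContinuous f := by
  obtain ⟨K, hK, hEK⟩ := exists_isCompact_superset_EfdR d
  have huc := (hK.cthickening (r := 1)).uniformContinuousOn_of_continuous hc.continuousOn
  rw [Metric.uniformContinuousOn_iff] at huc
  rw [Metric.uniformContinuous_iff]
  intro ε hε
  obtain ⟨δ, hδ, h⟩ := huc ε hε
  refine ⟨min δ 1, lt_min hδ one_pos, fun x y hxy => ?_⟩
  obtain ⟨z, hz⟩ := exists_add_latticeVec_mem x
  have hd : dist (x + latticeVec z) (y + latticeVec z) < min δ 1 := by
    rwa [dist_add_right]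
  have := h (x + latticeVec z) (Metric.self_subset_cthickening _ (hEK hz)) (y + latticeVec z)
    (Metric.mem_cthickening_of_dist_le _ _ _ _ (hEK hz)
      (by rw [dist_comm]; exact (hd.trans_le (min_le_right _ _)).le))
    (hd.trans_le (min_le_left _ _))
  rwa [hf.add_latticeVec, hf.add_latticeVec] at this

lemma volume_eq_zero_of_inter_EfdR {d : ℕ} {S : Set (Rd d)} (hS : PeriodicRd (· ∈ S))
    (h : volume (S ∩ EfdR d) = 0) : volume S = 0 := by
  have hsub : S ⊆ ⋃ z : Fin d → ℤ, (fun x => x + latticeVec z) ⁻¹' (S ∩ EfdR d) := by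
    intro x hx
    obtain ⟨z, hz⟩ := exists_add_latticeVec_mem x
    exact Set.mem_iUnion.2 ⟨z, (hS.add_latticeVec z x).symm ▸ hx, hz⟩
  refine measure_mono_null hsub (measure_iUnion_null fun z => ?_)
  rw [measure_preimage_add_right, h]

lemma PeriodicRd.fderiv {d : ℕ} {F : Type*} [NormedAddCommGroup F] [NormedSpace ℝ F]
    {f : Rd d → F} (hf : PeriodicRd f) : PeriodicRd (fderiv ℝ f) := by
  intro x j
  rw [← fderiv_comp_add_right]
  congr 1
  exact funext fun y => hf y j

/-! ### The Laplacian -/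

lemma contDiff_fderiv_single {d : ℕ} {f : Rd d → ℝ} {n m : WithTop ℕ∞} (hf : ContDiff ℝ n f)
    (hmn : m + 1 ≤ n) (w : Rd d) : ContDiff ℝ m (fun y => fderiv ℝ f y w) :=
  (hf.fderiv_right hmn).clm_apply contDiff_const

lemma continuous_lapRd {d : ℕ} {f : Rd d → ℝ} (hf : ContDiff ℝ 2 f) : Continuous (lapRd f) := by
  unfold lapRd
  refine continuous_finsetSum _ fun j _ => ?_
  exact (contDiff_fderiv_single (m := 0)
    (contDiff_fderiv_single (m := 1) hf (by norm_num [one_add_one_eq_two]) _) (by simp) _).continuous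

lemma lapRd_add {d : ℕ} {f g : Rd d → ℝ} (hf : ContDiff ℝ 2 f) (hg : ContDiff ℝ 2 g) (x : Rd d) :
    lapRd (fun y => f y + g y) x = lapRd f x + lapRd g x := by
  simp only [lapRd, ← Finset.sum_add_distrib]
  refine Finset.sum_congr rfl fun j _ => ?_
  have h1 : (fun y => fderiv ℝ (fun y => f y + g y) y (EuclideanSpace.single j (1 : ℝ))) =
      fun y => fderiv ℝ f y (EuclideanSpace.single j (1 : ℝ)) +
        fderiv ℝ g y (EuclideanSpace.single j (1 : ℝ)) := by
    funext y
    rw [fderiv_fun_add (hf.differentiable (by simp) y) (hg.differentiable (by simp) y)]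
    rfl
  rw [h1, fderiv_fun_add]
  · rfl
  · exact (contDiff_fderiv_single (m := 1) hf (by norm_num [one_add_one_eq_two]) _).differentiable
      (by simp) x
  · exact (contDiff_fderiv_single (m := 1) hg (by norm_num [one_add_one_eq_two]) _).differentiable
      (by simp) x

lemma lapRd_neg {d : ℕ} (f : Rd d → ℝ) (x : Rd d) : lapRd (fun y => -f y) x = -lapRd f x := by
  simp [lapRd, fderiv_fun_neg]

lemma lapRd_const {d : ℕ} (c : ℝ) (x : Rd d) : lapRd (fun _ => c) x = 0 := by
  simp [lapRd]

/-- The chain rule `Δ(G ∘ v) = G''(v) |∇v|² + G'(v) Δv`. -/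
lemma lapRd_comp {d : ℕ} {G g g' : ℝ → ℝ} {v : Rd d → ℝ} (hv : ContDiff ℝ 2 v)
    (hG : ∀ s, HasDerivAt G (g s) s) (hg : ∀ s, HasDerivAt g (g' s) s) (x : Rd d) :
    lapRd (fun y => G (v y)) x =
      g' (v x) * (∑ j, fderiv ℝ v x (EuclideanSpace.single j (1 : ℝ)) ^ 2)
        + g (v x) * lapRd v x := by
  simp only [lapRd, Finset.mul_sum, ← Finset.sum_add_distrib]
  refine Finset.sum_congr rfl fun j _ => ?_
  have hd : ∀ y, HasFDerivAt v (fderiv ℝ v y) y := fun y =>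
    (hv.differentiable (by simp) y).hasFDerivAt
  have h1 : (fun y => fderiv ℝ (fun y => G (v y)) y (EuclideanSpace.single j (1 : ℝ))) =
      fun y => g (v y) * fderiv ℝ v y (EuclideanSpace.single j (1 : ℝ)) := by
    funext y
    have h : HasFDerivAt (fun y => G (v y)) (g (v y) • fderiv ℝ v y) y :=
      (hG (v y)).comp_hasFDerivAt y (hd y)
    simp [h.fderiv]
  have h2 : HasFDerivAt (fun y => fderiv ℝ v y (EuclideanSpace.single j (1 : ℝ)))
      (fderiv ℝ (fun y => fderiv ℝ v y (EuclideanSpace.single j (1 : ℝ))) x) x :=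
    ((contDiff_fderiv_single (m := 1) hv (by norm_num [one_add_one_eq_two]) _).differentiable
      (by simp) x).hasFDerivAt
  have h3 : HasFDerivAt (fun y => g (v y)) (g' (v x) • fderiv ℝ v x) x :=
    (hg (v x)).comp_hasFDerivAt x (hd x)
  rw [h1, (h3.fun_mul h2).fderiv]
  simp
  ring

lemma integral_mul_fderiv_eq {d : ℕ} {f g : Rd d → ℝ} (hf : ContDiff ℝ 1 f) (hg : ContDiff ℝ 1 g)
    (hgc : HasCompactSupport g) (w : Rd d) :
    ∫ x, f x * fderiv ℝ g x w = -∫ x, fderiv ℝ f x w * g x := by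
  have hf' := (contDiff_fderiv_single (m := 0) hf (by simp) w).continuous
  have hg' := (contDiff_fderiv_single (m := 0) hg (by simp) w).continuous
  refine integral_mul_fderiv_eq_neg_fderiv_mul_of_integrable ?_ ?_ ?_
    (fun x _ => hf.differentiable (by simp) x) (fun x _ => hg.differentiable (by simp) x)
  · exact (hf'.mul hg.continuous).integrable_of_hasCompactSupport hgc.mul_left
  · exact (hf.continuous.mul hg').integrable_of_hasCompactSupport (hgc.fderiv_apply ℝ w).mul_left
  · exact (hf.continuous.mul hg.continuous).integrable_of_hasCompactSupport hgc.mul_left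

/-- Green's identity on `ℝ^d` against a compactly supported function. -/
lemma integral_mul_lapRd {d : ℕ} {f g : Rd d → ℝ} (hf : ContDiff ℝ 2 f) (hg : ContDiff ℝ 2 g)
    (hgc : HasCompactSupport g) : ∫ x, f x * lapRd g x = ∫ x, lapRd f x * g x := by
  have h1 {f : Rd d → ℝ} (hf : ContDiff ℝ 2 f) (w : Rd d) :
      ContDiff ℝ 1 (fun y => fderiv ℝ f y w) :=
    contDiff_fderiv_single hf (by norm_num [one_add_one_eq_two]) w
  have h0 {f : Rd d → ℝ} (hf : ContDiff ℝ 1 f) (w : Rd d) :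
      Continuous (fun y => fderiv ℝ f y w) :=
    (contDiff_fderiv_single (m := 0) hf (by simp) w).continuous
  simp only [lapRd, Finset.mul_sum, Finset.sum_mul]
  rw [integral_finsetSum, integral_finsetSum]
  · refine Finset.sum_congr rfl fun j _ => ?_
    rw [integral_mul_fderiv_eq (hf.of_le (by norm_num)) (h1 hg _) (hgc.fderiv_apply ℝ _),
      integral_mul_fderiv_eq (h1 hf _) (hg.of_le (by norm_num)) hgc, neg_neg]
  · intro j _
    exact ((h0 (h1 hf _) _).mul hg.continuous).integrable_of_hasCompactSupport hgc.mul_left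
  · intro j _
    exact (hf.continuous.mul (h0 (h1 hg _) _)).integrable_of_hasCompactSupport
      ((hgc.fderiv_apply ℝ _).fderiv_apply ℝ _).mul_left

/-! ### Periodic functions with non-negative Laplacian -/

/-- The Laplacian of a periodic function integrates to zero over a period cell, so that it
vanishes if it is non-negative. -/
lemma lapRd_eq_zero_of_nonneg {d : ℕ} {h : Rd d → ℝ} (hh : ContDiff ℝ 2 h) (hper : PeriodicRd h)
    (hlap : ∀ x, 0 ≤ lapRd h x) (x : Rd d) : lapRd h x = 0 := by
  cases d with
  | zero => simp [lapRd]
  | succ n =>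
    let a : Fin (n + 1) → ℝ := fun i => x i - Real.pi
    let b : Fin (n + 1) → ℝ := fun i => x i + Real.pi
    let T : (Fin (n + 1) → ℝ) →L[ℝ] Rd (n + 1) :=
      ((PiLp.continuousLinearEquiv 2 ℝ (fun _ : Fin (n + 1) => ℝ)).symm : _ →L[ℝ] _)
    let D : Fin (n + 1) → Rd (n + 1) → ℝ := fun i y => fderiv ℝ h y (EuclideanSpace.single i 1)
    have hD : ∀ i, ContDiff ℝ 1 (D i) := fun i =>
      contDiff_fderiv_single hh (by norm_num [one_add_one_eq_two]) _
    have hDper : ∀ i, PeriodicRd (D i) := fun i y k => by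
      simp only [D]
      rw [hper.fderiv y k]
    have hTsingle : ∀ i : Fin (n + 1), T (Pi.single i 1) = EuclideanSpace.single i (1 : ℝ) :=
      fun i => rfl
    have hlapT : Continuous fun y => lapRd h (T y) := (continuous_lapRd hh).comp T.continuous
    have hint : IntegrableOn (fun y => lapRd h (T y)) (Set.Icc a b) :=
      hlapT.continuousOn.integrableOn_compact isCompact_Icc
    have hle : a ≤ b := fun i => by
      simp only [a, b]
      linarith [Real.pi_pos]
    have hdiv := integral_divergence_of_hasFDerivAt_off_countable' a b hle
      (fun i y => D i (T y)) (fun i y => (fderiv ℝ (D i) (T y)).comp T) ∅ Set.countable_empty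
      (fun i => ((hD i).continuous.comp T.continuous).continuousOn)
      (fun y _ i => ((hD i).differentiable (by simp) (T y)).hasFDerivAt.comp y T.hasFDerivAt)
      (by simp only [ContinuousLinearMap.comp_apply, hTsingle]; exact hint)
    have hface : ∀ (i : Fin (n + 1)) (y : Fin n → ℝ),
        D i (T (i.insertNth (b i) y)) = D i (T (i.insertNth (a i) y)) := by
      intro i y
      rw [← hDper i (T (i.insertNth (a i) y)) i]
      congr 1
      ext k
      refine Fin.succAboveCases i ?_ (fun k => ?_) k
      · simp [T, a, b]
        ring
      · simp [T]
    have hzero : ∫ y in Set.Icc a b, lapRd h (T y) = 0 := by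
      simp only [ContinuousLinearMap.comp_apply, hTsingle, hface, sub_self,
        Finset.sum_const_zero] at hdiv
      exact hdiv
    rw [setIntegral_eq_zero_iff_of_nonneg_ae (Filter.Eventually.of_forall fun y => hlap _) hint]
      at hzero
    have hopen : Set.univ.pi (fun i => Set.Ioo (a i) (b i)) ⊆ Set.Icc a b := by
      rw [← Set.pi_univ_Icc]
      exact Set.pi_mono fun i _ => Set.Ioo_subset_Icc_self
    have heq := Measure.eqOn_open_of_ae_eq (ae_restrict_of_ae_restrict_of_subset hopen hzero)
      (isOpen_set_pi Set.finite_univ fun i _ => isOpen_Ioo) hlapT.continuousOn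
      continuousOn_const
    have hx : WithLp.ofLp x ∈ Set.univ.pi (fun i => Set.Ioo (a i) (b i)) := fun i _ => by
      simp only [a, b, Set.mem_Ioo]
      constructor <;> linarith [Real.pi_pos]
    exact heq hx

/-- A periodic `C²` function with non-negative Laplacian is constant. -/
lemma PeriodicRd.eq_of_lapRd_nonneg {d : ℕ} {h : Rd d → ℝ} (hper : PeriodicRd h)
    (hh : ContDiff ℝ 2 h) (hlap : ∀ x, 0 ≤ lapRd h x) (x y : Rd d) : h x = h y := by
  have h0 := lapRd_eq_zero_of_nonneg hh hper hlap
  have hsq : ∀ x, lapRd (fun y => h y ^ 2) x =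
      2 * ∑ j, _root_.fderiv ℝ h x (EuclideanSpace.single j (1 : ℝ)) ^ 2 := by
    intro x
    have := lapRd_comp (G := fun s => s ^ 2) (g := fun s => 2 * s) (g' := fun _ => 2) hh
      (fun s => by simpa using hasDerivAt_pow 2 s)
      (fun s => by simpa using (hasDerivAt_id s).const_mul 2) x
    rw [this, h0 x, mul_zero, add_zero]
  have hsum := lapRd_eq_zero_of_nonneg (hh.pow 2) (fun x j => by simp only [hper x j])
    (fun x => by rw [hsq]; positivity)
  refine is_const_of_fderiv_eq_zero (𝕜 := ℝ) (hh.differentiable (by simp)) (fun z => ?_) x y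
  have hz := hsum z
  rw [hsq] at hz
  have hz' := (Finset.sum_eq_zero_iff_of_nonneg (fun j _ => sq_nonneg _)).1
    ((mul_eq_zero.1 hz).resolve_left two_ne_zero)
  have hlin : ((_root_.fderiv ℝ h z : Rd d →L[ℝ] ℝ) : Rd d →ₗ[ℝ] ℝ) = 0 := by
    refine (EuclideanSpace.basisFun (Fin d) ℝ).toBasis.ext fun j => ?_
    simpa using hz' j (Finset.mem_univ j)
  exact ContinuousLinearMap.coe_injective hlin

/-! ### Mollification -/

open ContinuousLinearMap in
lemma fderiv_convolution_apply {d : ℕ} {f u : Rd d → ℝ} (hf : ContDiff ℝ 1 f)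
    (hfc : HasCompactSupport f) (hu : Continuous u) (x w : Rd d) :
    fderiv ℝ (convolution f u (lsmul ℝ ℝ) volume) x w =
      convolution (fun y => fderiv ℝ f y w) u (lsmul ℝ ℝ) volume x := by
  have hul : LocallyIntegrable u volume := hu.locallyIntegrable
  rw [(hfc.hasFDerivAt_convolution_left (lsmul ℝ ℝ) hf hul x).fderiv]
  have hex := (hfc.fderiv ℝ).convolutionExists_left ((lsmul ℝ ℝ).precompL (Rd d))
    (hf.continuous_fderiv (by simp)) hul x
  simp only [convolution]
  rw [← ContinuousLinearMap.apply_apply (𝕜 := ℝ) w, ← ContinuousLinearMap.integral_comp_comm]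
  · rfl
  · exact hex

open ContinuousLinearMap in
lemma lapRd_convolution {d : ℕ} {f u : Rd d → ℝ} (hf : ContDiff ℝ 2 f)
    (hfc : HasCompactSupport f) (hu : Continuous u) (x : Rd d) :
    lapRd (convolution f u (lsmul ℝ ℝ) volume) x = ∫ y, u y * lapRd f (x - y) := by
  have h1 (w : Rd d) : ContDiff ℝ 1 (fun y => fderiv ℝ f y w) :=
    contDiff_fderiv_single hf (by norm_num [one_add_one_eq_two]) w
  have h2 (w w' : Rd d) : Continuous fun y => fderiv ℝ (fun z => fderiv ℝ f z w) y w' :=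
    (contDiff_fderiv_single (m := 0) (h1 w) (by simp) w').continuous
  have hul : LocallyIntegrable u volume := hu.locallyIntegrable
  simp only [lapRd, Finset.mul_sum]
  rw [integral_finsetSum]
  · refine Finset.sum_congr rfl fun j _ => ?_
    have h3 : (fun y => fderiv ℝ (convolution f u (lsmul ℝ ℝ) volume) y
        (EuclideanSpace.single j (1 : ℝ))) =
        convolution (fun y => fderiv ℝ f y (EuclideanSpace.single j (1 : ℝ))) u (lsmul ℝ ℝ)
          volume :=
      funext fun y => fderiv_convolution_apply (hf.of_le (by norm_num)) hfc hu y _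
    rw [h3, fderiv_convolution_apply (h1 _) (hfc.fderiv_apply ℝ _) hu, convolution_lsmul_swap]
    simp only [smul_eq_mul, mul_comm]
  · intro j _
    have hc := ((hfc.fderiv_apply ℝ (EuclideanSpace.single j (1 : ℝ))).fderiv_apply ℝ
      (EuclideanSpace.single j (1 : ℝ))).comp_homeomorph (Homeomorph.subLeft x)
    exact (hu.mul ((h2 _ _).comp (continuous_sub_left x))).integrable_of_hasCompactSupport
      hc.mul_left

lemma lapRd_comp_sub_left {d : ℕ} {f : Rd d → ℝ} (hf : ContDiff ℝ 2 f) (x y : Rd d) :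
    lapRd (fun z => f (x - z)) y = lapRd f (x - y) := by
  have key {g : Rd d → ℝ} (hg : ContDiff ℝ 1 g) (z w : Rd d) :
      fderiv ℝ (fun z => g (x - z)) z w = -fderiv ℝ g (x - z) w := by
    have h : HasFDerivAt (fun z => g (x - z)) ((fderiv ℝ g (x - z)).comp (-.id ℝ (Rd d))) z :=
      (hg.differentiable (by simp) (x - z)).hasFDerivAt.comp z ((hasFDerivAt_id z).const_sub x)
    simp [h.fderiv]
  simp only [lapRd, key (hf.of_le (by norm_num))]
  refine Finset.sum_congr rfl fun j _ => ?_
  rw [fderiv_fun_neg, _root_.neg_apply,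
    key (contDiff_fderiv_single hf (by norm_num [one_add_one_eq_two]) _), neg_neg]

open ContinuousLinearMap in
/-- Mollification at scale `r`. -/
lemma exists_mollification {d : ℕ} {u : Rd d → ℝ} (hu : Continuous u) {r : ℝ} (hr : 0 < r) :
    ∃ w : Rd d → ℝ, ContDiff ℝ 2 w ∧ (PeriodicRd u → PeriodicRd w) ∧
      (∀ x η, (∀ y ∈ Metric.ball x r, dist (u y) (u x) ≤ η) → dist (w x) (u x) ≤ η) ∧
      ∀ S : Set (Rd d),
        (∀ χ : Rd d → ℝ, ContDiff ℝ (⊤ : ℕ∞) χ → HasCompactSupport χ → (∀ x, 0 ≤ χ x) →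
          tsupport χ ⊆ S → 0 ≤ ∫ x : Rd d, u x * lapRd χ x) →
        ∀ x, Metric.closedBall x r ⊆ S → 0 ≤ lapRd w x := by
  let ρ : ContDiffBump (0 : Rd d) := ⟨r / 2, r, by positivity, by linarith⟩
  have hρ : ∀ {n : ℕ∞}, ContDiff ℝ n (ρ.normed volume) := ρ.contDiff_normed
  have hρc : HasCompactSupport (ρ.normed volume) := ρ.hasCompactSupport_normed
  refine ⟨convolution (ρ.normed volume) u (lsmul ℝ ℝ) volume,
    hρc.contDiff_convolution_left (lsmul ℝ ℝ) (hρ (n := 2)) hu.locallyIntegrable, ?_, ?_, ?_⟩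
  · intro hper x j
    simp only [convolution]
    congr 1
    funext y
    rw [add_sub_right_comm, hper]
  · intro x η h
    exact ρ.dist_normed_convolution_le hu.aestronglyMeasurable h
  · intro S hS x hx
    rw [lapRd_convolution (hρ (n := 2)) hρc hu]
    have := hS (fun y => ρ.normed volume (x - y)) (hρ.comp (contDiff_const.sub contDiff_id))
      (hρc.comp_homeomorph (Homeomorph.subLeft x)) (fun y => ρ.nonneg_normed _) ?_
    · simpa only [lapRd_comp_sub_left (hρ (n := 2))] using this
    · refine Set.Subset.trans ?_ hx
      refine closure_minimal (fun y hy => ?_) Metric.isClosed_closedBall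
      have : x - y ∈ Function.support (ρ.normed volume) := hy
      rw [ρ.support_normed_eq, mem_ball_zero_iff, ← dist_eq_norm, dist_comm] at this
      exact this.le

/-- A continuous periodic function that is subharmonic in the sense of distributions is
constant. -/
lemma PeriodicRd.eq_of_weakly_subharmonic {d : ℕ} {W : Rd d → ℝ} (hper : PeriodicRd W)
    (hW : Continuous W)
    (hsub : ∀ χ : Rd d → ℝ, ContDiff ℝ (⊤ : ℕ∞) χ → HasCompactSupport χ → (∀ x, 0 ≤ χ x) →
      0 ≤ ∫ x : Rd d, W x * _root_.lapRd χ x) (x y : Rd d) : W x = W y := by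
  refine eq_of_forall_dist_le fun ε hε => ?_
  obtain ⟨r, hr, hunif⟩ := Metric.uniformContinuous_iff.1 (hper.uniformContinuous hW) (ε / 2)
    (half_pos hε)
  obtain ⟨w, hw, hwper, hclose, hlap⟩ := exists_mollification hW hr
  have hconst : w x = w y := (hwper hper).eq_of_lapRd_nonneg hw
    (fun z => hlap Set.univ (fun χ h1 h2 h3 _ => hsub χ h1 h2 h3) z (Set.subset_univ _)) x y
  have hx : ∀ z, dist (w z) (W z) ≤ ε / 2 := fun z =>
    hclose z (ε / 2) fun y hy => (hunif hy).le
  have h1 := hx x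
  have h2 := hx y
  rw [Real.dist_eq, abs_le] at *
  rw [hconst] at h1
  constructor <;> linarith [h1.1, h1.2, h2.1, h2.2]

/-! ### The maximum of a subsolution and an obstacle -/

/-- Smooth convex approximations of the positive part. -/
lemma exists_convex_approx_posPart {δ : ℝ} (hδ : 0 < δ) :
    ∃ G g : ℝ → ℝ, ContDiff ℝ 2 G ∧ (∀ s, HasDerivAt G (g s) s) ∧
      (∀ s, HasDerivAt g (deriv g s) s) ∧ (∀ s, 0 ≤ deriv g s) ∧ (∀ s, 0 ≤ g s) ∧
      (∀ s, g s ≤ 1) ∧ (∀ s ≤ δ, g s = 0) ∧ (∀ s, 2 * δ ≤ s → g s = 1) ∧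
      ∀ s, |G s - max s 0| ≤ 2 * δ := by
  let g : ℝ → ℝ := fun s => Real.smoothTransition ((s - δ) / δ)
  have hg : ContDiff ℝ 1 g := by
    have h : ContDiff ℝ 1 Real.smoothTransition := Real.smoothTransition.contDiff (n := 1)
    exact h.comp ((contDiff_id.sub contDiff_const).div_const δ)
  have hmono : Monotone g := fun s t hst => Real.smoothTransition.monotone (by gcongr)
  have h0 : ∀ s, 0 ≤ g s := fun s => Real.smoothTransition.nonneg _
  have h1 : ∀ s, g s ≤ 1 := fun s => Real.smoothTransition.le_one _
  have hzero : ∀ s ≤ δ, g s = 0 := fun s hs =>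
    Real.smoothTransition.zero_of_nonpos (div_nonpos_of_nonpos_of_nonneg (by linarith) hδ.le)
  have hone : ∀ s, 2 * δ ≤ s → g s = 1 := fun s hs =>
    Real.smoothTransition.one_of_one_le ((one_le_div hδ).2 (by linarith))
  have hG : ∀ s, HasDerivAt (fun s => ∫ t in (0 : ℝ)..s, g t) (g s) s := fun s =>
    hg.continuous.integral_hasStrictDerivAt 0 s |>.hasDerivAt
  have hbd : ∀ s, 0 ≤ s → (0 ≤ ∫ t in (0 : ℝ)..s, g t) ∧ (∫ t in (0 : ℝ)..s, g t) ≤ s := by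
    intro s hs
    refine ⟨intervalIntegral.integral_nonneg hs fun t _ => h0 t, ?_⟩
    have := intervalIntegral.integral_mono_on hs (hg.continuous.intervalIntegrable 0 s)
      (intervalIntegrable_const (μ := volume) (c := (1 : ℝ))) fun t _ => h1 t
    simpa using this
  refine ⟨fun s => ∫ t in (0 : ℝ)..s, g t, g, ?_, hG,
    fun s => (hg.differentiable (by simp) s).hasDerivAt, fun s => hmono.deriv_nonneg, h0, h1, hzero,
    hone, fun s => ?_⟩
  · rw [show (2 : WithTop ℕ∞) = 1 + 1 from one_add_one_eq_two.symm, contDiff_succ_iff_deriv]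
    refine ⟨fun s => (hG s).differentiableAt, by simp, ?_⟩
    rwa [show deriv (fun s => ∫ t in (0 : ℝ)..s, g t) = g from funext fun s => (hG s).deriv]
  · rcases le_total s 0 with hs | hs
    · have : ∫ t in (0 : ℝ)..s, g t = 0 := by
        rw [intervalIntegral.integral_congr (g := fun _ => (0 : ℝ)), intervalIntegral.integral_zero]
        intro t ht
        rw [Set.uIcc_of_ge hs] at ht
        exact hzero t (ht.2.trans hδ.le)
      simp only [this, max_eq_right hs, sub_zero, abs_zero]
      positivity
    · rw [max_eq_left hs, abs_le]
      obtain ⟨hl, hu⟩ := hbd s hs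
      rcases le_total s (2 * δ) with hs2 | hs2
      · constructor <;> linarith
      · obtain ⟨hl', hu'⟩ := hbd (2 * δ) (by positivity)
        have hsplit : ∫ t in (0 : ℝ)..s, g t = (∫ t in (0 : ℝ)..(2 * δ), g t) + (s - 2 * δ) := by
          rw [← intervalIntegral.integral_add_adjacent_intervals (b := 2 * δ)
            (hg.continuous.intervalIntegrable _ _) (hg.continuous.intervalIntegrable _ _)]
          congr 1
          rw [intervalIntegral.integral_congr (g := fun _ => (1 : ℝ))]
          · simp
          · intro t ht
            rw [Set.uIcc_of_le hs2] at ht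
            exact hone t ht.1
        simp only [hsplit]
        constructor <;> linarith

/-- If `u` is subharmonic where it lies above `ψ`, then `max u ψ` is a uniform limit of functions
whose Laplacian is bounded below by that of `ψ`, weighted by a cutoff concentrated near
`{u ≤ ψ}`. -/
lemma exists_approx_max {d : ℕ} {u ψ : Rd d → ℝ} (hu : Continuous u) (huper : PeriodicRd u)
    (hψ : ContDiff ℝ 2 ψ) (hψper : PeriodicRd ψ)
    (hsub : ∀ χ : Rd d → ℝ, ContDiff ℝ (⊤ : ℕ∞) χ → HasCompactSupport χ → (∀ x, 0 ≤ χ x) →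
      tsupport χ ⊆ {x | ψ x < u x} → 0 ≤ ∫ x : Rd d, u x * lapRd χ x) {δ : ℝ} (hδ : 0 < δ) :
    ∃ F θ : Rd d → ℝ, ContDiff ℝ 2 F ∧ Continuous θ ∧ (∀ x, |F x - max (u x) (ψ x)| ≤ 3 * δ) ∧
      (∀ x, 0 ≤ θ x) ∧ (∀ x, θ x ≤ 1) ∧ (∀ x, 3 * δ ≤ u x - ψ x → θ x = 0) ∧
      ∀ x, θ x * lapRd ψ x ≤ lapRd F x := by
  obtain ⟨G, g, hGC, hG, hg, hg', hg0, hg1, hgzero, hgone, hGmax⟩ :=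
    exists_convex_approx_posPart hδ
  obtain ⟨r₁, hr₁, hunif₁⟩ := Metric.uniformContinuous_iff.1 (huper.uniformContinuous hu) (δ / 2)
    (half_pos hδ)
  obtain ⟨r₂, hr₂, hunif₂⟩ := Metric.uniformContinuous_iff.1
    ((huper.uniformContinuous hu).sub (hψper.uniformContinuous hψ.continuous)) (δ / 2)
    (half_pos hδ)
  have hr : 0 < min r₁ (r₂ / 2) := lt_min hr₁ (half_pos hr₂)
  obtain ⟨w, hw, -, hclose, hlap⟩ := exists_mollification hu hr
  have hwu : ∀ x, |w x - u x| ≤ δ / 2 := fun x =>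
    hclose x (δ / 2) fun y hy => (hunif₁ (lt_of_lt_of_le hy (min_le_left _ _))).le
  have hv : ContDiff ℝ 2 fun x => w x + -ψ x := hw.add hψ.neg
  have hgc : Continuous g := continuous_iff_continuousAt.2 fun s => (hg s).continuousAt
  refine ⟨fun x => G (w x + -ψ x) + ψ x, fun x => 1 - g (w x + -ψ x), (hGC.comp hv).add hψ,
    continuous_const.sub (hgc.comp hv.continuous), fun x => ?_, fun x => sub_nonneg.2 (hg1 _),
    fun x => sub_le_self _ (hg0 _), fun x hx => ?_, fun x => ?_⟩
  · have h1 := hGmax (w x + -ψ x)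
    have h2 : |max (w x + -ψ x) 0 - max (u x - ψ x) 0| ≤ δ / 2 :=
      (abs_max_sub_max_le_abs _ _ _).trans (by simpa [← sub_eq_add_neg] using hwu x)
    have h3 : max (u x) (ψ x) = max (u x - ψ x) 0 + ψ x := by
      rw [← max_add_add_right, sub_add_cancel, zero_add]
    rw [abs_le] at *
    constructor <;> linarith [h1.1, h1.2, h2.1, h2.2]
  · have := (abs_le.1 (hwu x)).1
    have hge : 2 * δ ≤ w x + -ψ x := by linarith
    simp only [hgone _ hge, sub_self]
  · have hlapv : lapRd (fun x => w x + -ψ x) x = lapRd w x - lapRd ψ x := by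
      rw [lapRd_add hw hψ.neg, lapRd_neg, sub_eq_add_neg]
    have hGv : ContDiff ℝ 2 fun x => G (w x + -ψ x) := hGC.comp hv
    rw [lapRd_add hGv hψ, lapRd_comp hv hG hg, hlapv]
    have h1 : 0 ≤ deriv g (w x + -ψ x) *
        ∑ j, fderiv ℝ (fun x => w x + -ψ x) x (EuclideanSpace.single j (1 : ℝ)) ^ 2 :=
      mul_nonneg (hg' _) (Finset.sum_nonneg fun j _ => sq_nonneg _)
    have h2 : 0 ≤ g (w x + -ψ x) * lapRd w x := by
      rcases le_or_gt (w x + -ψ x) δ with hle | hlt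
      · rw [hgzero _ hle, zero_mul]
      · refine mul_nonneg (hg0 _) (hlap _ hsub x fun y hy => ?_)
        have hyx : dist y x < r₂ :=
          (Metric.mem_closedBall.1 hy).trans_lt ((min_le_right _ _).trans_lt (half_lt_self hr₂))
        have h3 := hunif₂ hyx
        rw [Real.dist_eq, abs_lt] at h3
        have h4 := (abs_le.1 (hwu x)).2
        simp only [Set.mem_ofPred_eq] at h3 ⊢
        linarith [h3.1]
    linarith

/-- If `u` is subharmonic where it lies above `ψ`, and `ψ` is subharmonic almost everywhere on
`{u ≤ ψ}`, then `max u ψ` is constant. -/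
lemma max_eq_max_of_subharmonic {d : ℕ} {u ψ : Rd d → ℝ} (hu : Continuous u)
    (huper : PeriodicRd u) (hψ : ContDiff ℝ 2 ψ) (hψper : PeriodicRd ψ)
    (hsub : ∀ χ : Rd d → ℝ, ContDiff ℝ (⊤ : ℕ∞) χ → HasCompactSupport χ → (∀ x, 0 ≤ χ x) →
      tsupport χ ⊆ {x | ψ x < u x} → 0 ≤ ∫ x : Rd d, u x * lapRd χ x)
    (hae : ∀ᵐ x, u x ≤ ψ x → 0 ≤ lapRd ψ x) (x y : Rd d) :
    max (u x) (ψ x) = max (u y) (ψ y) := by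
  have hW : Continuous fun x => max (u x) (ψ x) := hu.max hψ.continuous
  refine PeriodicRd.eq_of_weakly_subharmonic (W := fun x => max (u x) (ψ x))
    (fun x j => by simp only [huper x j, hψper x j]) hW (fun χ hχ hχc hχ0 => ?_) x y
  have hχ2 : ContDiff ℝ 2 χ := hχ.of_le (WithTop.coe_le_coe.2 le_top)
  have hδ : ∀ n : ℕ, (0 : ℝ) < 1 / ((n : ℝ) + 1) := fun n => Nat.one_div_pos_of_nat
  choose F θ hF hθ hFmax hθ0 hθ1 hθz hlapF using fun n : ℕ =>
    exists_approx_max hu huper hψ hψper hsub (hδ n)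
  have hlim : Filter.Tendsto (fun n : ℕ => 3 * (1 / ((n : ℝ) + 1))) Filter.atTop (nhds 0) := by
    simpa using (tendsto_one_div_add_atTop_nhds_zero_nat (𝕜 := ℝ)).const_mul 3
  have hlapχ : Continuous (lapRd χ) := continuous_lapRd hχ2
  have hlapχc : HasCompactSupport (lapRd χ) := by
    refine hχc.mono' fun z hz => by_contra fun hzn => hz ?_
    exact Finset.sum_eq_zero fun j _ => by
      have h1 : z ∉ tsupport fun y => fderiv ℝ χ y (EuclideanSpace.single j (1 : ℝ)) :=
        fun h => hzn (tsupport_fderiv_apply_subset ℝ _ h)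
      rw [fderiv_of_notMem_tsupport ℝ h1, zero_apply]
  have hlapψ : Continuous fun x => min (lapRd ψ x) 0 := (continuous_lapRd hψ).min continuous_const
  have hleft : Filter.Tendsto (fun n => ∫ x, F n x * lapRd χ x) Filter.atTop
      (nhds (∫ x, max (u x) (ψ x) * lapRd χ x)) := by
    refine tendsto_integral_of_dominated_convergence
      (fun x => (|max (u x) (ψ x)| + 3) * |lapRd χ x|)
      (fun n => ((hF n).continuous.mul hlapχ).aestronglyMeasurable) ?_
      (fun n => Filter.Eventually.of_forall fun x => ?_)
      (Filter.Eventually.of_forall fun x => Filter.Tendsto.mul_const _ ?_)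
    · exact ((hW.abs.add continuous_const).mul hlapχ.abs).integrable_of_hasCompactSupport
        (hlapχc.abs.mul_left)
    · rw [Real.norm_eq_abs, abs_mul]
      gcongr
      have h1 := hFmax n x
      have h2 : 3 * (1 / ((n : ℝ) + 1)) ≤ 3 := by
        have : 1 / ((n : ℝ) + 1) ≤ 1 :=
          (div_le_one (by positivity)).2 (by linarith [n.cast_nonneg (α := ℝ)])
        linarith
      have h3 := abs_sub_abs_le_abs_sub (F n x) (max (u x) (ψ x))
      linarith
    · rw [tendsto_iff_dist_tendsto_zero]
      exact squeeze_zero (fun n => dist_nonneg) (fun n => hFmax n x) hlim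
  have hright : Filter.Tendsto (fun n => ∫ x, θ n x * min (lapRd ψ x) 0 * χ x) Filter.atTop
      (nhds (∫ _ : Rd d, (0 : ℝ))) := by
    refine tendsto_integral_of_dominated_convergence
      (fun x => |min (lapRd ψ x) 0| * |χ x|)
      (fun n => (((hθ n).mul hlapψ).mul hχ.continuous).aestronglyMeasurable) ?_
      (fun n => Filter.Eventually.of_forall fun x => ?_) ?_
    · exact (hlapψ.abs.mul hχ.continuous.abs).integrable_of_hasCompactSupport hχc.abs.mul_left
    · rw [Real.norm_eq_abs, abs_mul, abs_mul, abs_of_nonneg (hθ0 n x)]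
      gcongr
      exact mul_le_of_le_one_left (abs_nonneg _) (hθ1 n x)
    · filter_upwards [hae] with x hx
      rcases le_or_gt (u x) (ψ x) with hle | hlt
      · simp [min_eq_right (hx hle)]
      · refine tendsto_const_nhds.congr' ?_
        filter_upwards [hlim.eventually_lt_const (sub_pos.2 hlt)] with n hn
        rw [hθz n x hn.le, zero_mul, zero_mul]
  rw [integral_zero] at hright
  refine le_of_tendsto_of_tendsto' hright hleft fun n => ?_
  rw [integral_mul_lapRd (hF n) hχ2 hχc]
  refine integral_mono
    ((((hθ n).mul hlapψ).mul hχ.continuous).integrable_of_hasCompactSupport hχc.mul_left)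
    (((continuous_lapRd (hF n)).mul hχ.continuous).integrable_of_hasCompactSupport hχc.mul_left)
    fun x => ?_
  exact mul_le_mul_of_nonneg_right
    ((mul_le_mul_of_nonneg_left (min_le_left _ _) (hθ0 n x)).trans (hlapF n x)) (hχ0 x)

/-! ### Solutions of the double obstacle problem -/

lemma PeriodicRd.neg {d : ℕ} {f : Rd d → ℝ} (hf : PeriodicRd f) : PeriodicRd fun x => -f x :=
  fun x j => by simp only [hf x j]

/-- Reflection exchanges the two obstacles. -/
lemma IsDOPSolution.neg {d : ℕ} {φm φp u : Rd d → ℝ} (h : IsDOPSolution φm φp u) :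
    IsDOPSolution (fun x => -φp x) (fun x => -φm x) (fun x => -u x) := by
  obtain ⟨hc, hper, hbd, hsub, hsup⟩ := h
  refine ⟨hc.neg, hper.neg, fun x => ⟨neg_le_neg (hbd x).2, neg_le_neg (hbd x).1⟩,
    fun χ h1 h2 h3 h4 => ?_, fun χ h1 h2 h3 h4 => ?_⟩
  · simp only [neg_mul, integral_neg, Left.nonneg_neg_iff]
    exact hsup χ h1 h2 h3 (by simpa using h4)
  · simp only [neg_mul, integral_neg, Left.neg_nonpos_iff]
    exact hsub χ h1 h2 h3 (by simpa using h4)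

/-- A solution whose lower contact set is negligible is constant. -/
lemma IsDOPSolution.eq_of_volume_eq_zero {d : ℕ} {φm φp u : Rd d → ℝ}
    (h : IsDOPSolution φm φp u) (hreg : ContDiff ℝ 2 φm) (hmper : PeriodicRd φm)
    (hvol : volume ({x | u x = φm x} ∩ EfdR d) = 0) (x y : Rd d) : u x = u y := by
  obtain ⟨hc, hper, hbd, hsub, -⟩ := h
  have hnull : volume {x | u x = φm x} = 0 :=
    volume_eq_zero_of_inter_EfdR (fun x j => by simp only [Set.mem_ofPred_eq, hper x j, hmper x j])
      hvol
  have hae : ∀ᵐ x, u x ≤ φm x → 0 ≤ lapRd φm x := by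
    have hne : ∀ᵐ x, ¬ u x = φm x := measure_eq_zero_iff_ae_notMem.1 hnull
    filter_upwards [hne] with x hx hle
    exact absurd (le_antisymm hle (hbd x).1) hx
  have := max_eq_max_of_subharmonic hc hper hreg hmper hsub hae x y
  rwa [max_eq_left (hbd x).1, max_eq_left (hbd y).1] at this

lemma IsDOPSolution.volume_pos {d : ℕ} {φm φp u : Rd d → ℝ} (h : IsDOPSolution φm φp u)
    (hreg : ContDiff ℝ 2 φm) (hmper : PeriodicRd φm) {x y : Rd d} (hxy : φp x < φm y) :
    0 < volume ({x | u x = φm x} ∩ EfdR d) := by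
  refine pos_iff_ne_zero.2 fun hvol => ?_
  have := h.eq_of_volume_eq_zero hreg hmper hvol x y
  linarith [(h.2.2.1 x).2, (h.2.2.1 y).1]

/-- If the lower obstacle lies below the level `c` and the upper obstacle touches it, then so does
every solution. -/
lemma IsDOPSolution.le_const {d : ℕ} {φm φp u : Rd d → ℝ} (h : IsDOPSolution φm φp u) {c : ℝ}
    (hm : ∀ x, φm x ≤ c) {y : Rd d} (hy : φp y ≤ c) (x : Rd d) : u x ≤ c := by
  obtain ⟨hc, hper, hbd, hsub, -⟩ := h
  have := max_eq_max_of_subharmonic (ψ := fun _ => c) hc hper contDiff_const (fun _ _ => rfl)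
    (fun χ h1 h2 h3 h4 => hsub χ h1 h2 h3 (h4.trans fun z hz => (hm z).trans_lt hz))
    (Filter.Eventually.of_forall fun x _ => (lapRd_const c x).ge) x y
  rw [max_eq_right ((hbd y).2.trans hy)] at this
  exact (le_max_left _ _).trans this.le

/-- **Proposition (positivity of the contact sets of the double obstacle problem).** -/
theorem dop_contact_sets_positive {d : ℕ}
    (φm φp : Rd d → ℝ) (τ : ℝ) (hτ : 0 < τ)
    (hmreg : ContDiff ℝ 2 φm) (hpreg : ContDiff ℝ 2 φp)
    (hmper : PeriodicRd φm) (hpper : PeriodicRd φp)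
    (hmnc : ∃ x y : Rd d, φm x ≠ φm y) (hpnc : ∃ x y : Rd d, φp x ≠ φp y)
    (hsep : ∀ x : Rd d, τ ≤ φp x - φm x)
    (hmaxmin : sInf (Set.range φp) ≤ sSup (Set.range φm)) :
    ∀ u : Rd d → ℝ, IsDOPSolution φm φp u →
      -- strict case: both contact sets have positive measure
      (sInf (Set.range φp) < sSup (Set.range φm) →
        0 < volume ({x | u x = φm x} ∩ EfdR d) ∧
        0 < volume ({x | u x = φp x} ∩ EfdR d)) ∧
      -- critical case: the contact sets are the extremal level sets
      (sInf (Set.range φp) = sSup (Set.range φm) →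
        {x | u x = φp x} = φp ⁻¹' {sInf (Set.range φp)} ∧
        {x | u x = φm x} = φm ⁻¹' {sSup (Set.range φm)}) := by
  intro u hsol
  have hpcomp := hpper.isCompact_range hpreg.continuous
  have hmcomp := hmper.isCompact_range hmreg.continuous
  obtain ⟨xp, hxp⟩ := hpcomp.sInf_mem (Set.range_nonempty φp)
  obtain ⟨xm, hxm⟩ := hmcomp.sSup_mem (Set.range_nonempty φm)
  refine ⟨fun hlt => ⟨?_, ?_⟩, fun heq => ?_⟩
  · exact hsol.volume_pos hmreg hmper (x := xp) (y := xm) (by rwa [hxp, hxm])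
  · have := hsol.neg.volume_pos hpreg.neg hpper.neg (x := xm) (y := xp)
      (by rw [hxp, hxm]; exact neg_lt_neg hlt)
    simpa only [neg_inj] using this
  · have hm : ∀ x, φm x ≤ sSup (Set.range φm) := fun x =>
      le_csSup hmcomp.bddAbove (Set.mem_range_self x)
    have hp : ∀ x, sInf (Set.range φp) ≤ φp x := fun x =>
      csInf_le hpcomp.bddBelow (Set.mem_range_self x)
    have hconst : ∀ x, u x = sSup (Set.range φm) := fun x =>
      le_antisymm (hsol.le_const hm (hxp.trans heq).le x) (neg_le_neg_iff.1
        (hsol.neg.le_const (fun x => neg_le_neg (heq ▸ hp x)) (neg_le_neg hxm.ge) x))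
    constructor <;> ext x <;> simp [hconst, heq, eq_comm]
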